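/- For all natural numbers n and k, the partition relation ω^{n·k} → (ω^n, k)² holds. -/

import Mathlib

open Ordinal Set

noncomputable def otype (A : Set Ordinal) : Ordinal.{1} :=
  Ordinal.type ((· < ·) : A → A → Prop)

def MonoColor (f : Finset Ordinal → Fin 2) (S : Set Ordinal) (c : Fin 2) : Prop :=
  ∀ x ∈ S, ∀ y ∈ S, x ≠ y → f {x, y} = c

def PartRel (α β γ : Ordinal.{0}) : Prop :=
  ∀ f : Finset Ordinal → Fin 2,
    (∃ B ⊆ Set.Iio α, otype B = Ordinal.lift.{1} β ∧ MonoColor f B 0) ∨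
    (∃ C ⊆ Set.Iio α, otype C = Ordinal.lift.{1} γ ∧ MonoColor f C 1)

def Indecomp (α : Ordinal) : Prop := ∀ β < α, ∀ γ < α, β + γ < α

/-- `IsLarge m A` is the recursive form of "`A` has order type at least `ω ^ m`": a large set of
rank `m + 1` contains an increasing `ω`-sequence of large blocks of rank `m`. -/
def IsLarge {X : Type*} [LT X] : ℕ → Set X → Prop
  | 0, A => A.Nonempty
  | m + 1, A => ∃ S : ℕ → Set X, (∀ i, S i ⊆ A ∧ IsLarge m (S i)) ∧
      ∀ i j, i < j → ∀ x ∈ S i, ∀ y ∈ S j, x < y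

namespace IsLarge

section

variable {X : Type*} [LT X]

theorem mono {m : ℕ} {A B : Set X} (hA : IsLarge m A) (hAB : A ⊆ B) : IsLarge m B := by
  cases m with
  | zero => exact Set.Nonempty.mono hAB hA
  | succ m =>
    obtain ⟨S, hS, hlt⟩ := hA
    exact ⟨S, fun i => ⟨(hS i).1.trans hAB, (hS i).2⟩, hlt⟩

theorem nonempty {m : ℕ} {A : Set X} (hA : IsLarge m A) : A.Nonempty := by
  induction m generalizing A with
  | zero => exact hA
  | succ m ih =>
    obtain ⟨S, hS, -⟩ := hA
    exact (ih (hS 0).2).mono (hS 0).1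

/-- Being large of rank `m` is a partition regular property. -/
theorem of_union {m : ℕ} {A B : Set X} (h : IsLarge m (A ∪ B)) :
    IsLarge m A ∨ IsLarge m B := by
  induction m generalizing A B with
  | zero => exact Set.union_nonempty.1 h
  | succ m ih =>
    obtain ⟨S, hS, hlt⟩ := h
    have key : ∀ C : Set X, (∃ᶠ i in Filter.atTop, IsLarge m (S i ∩ C)) → IsLarge (m + 1) C := by
      intro C hC
      obtain ⟨φ, hφ, hφC⟩ := Filter.extraction_of_frequently_atTop hC
      exact ⟨fun i => S (φ i) ∩ C, fun i => ⟨Set.inter_subset_right, hφC i⟩,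
        fun i j hij x hx y hy => hlt _ _ (hφ hij) x hx.1 y hy.1⟩
    have hor : ∃ᶠ i in Filter.atTop, IsLarge m (S i ∩ A) ∨ IsLarge m (S i ∩ B) :=
      Filter.Frequently.of_forall fun i => ih <| (hS i).2.mono fun x hx =>
        ((hS i).1 hx).imp (fun h => ⟨hx, h⟩) (fun h => ⟨hx, h⟩)
    exact (Filter.frequently_or_distrib.1 hor).imp (key A) (key B)

theorem diff_biUnion {ι : Type*} {m : ℕ} {A : Set X} (hA : IsLarge m A) (N : ι → Set X)
    (T : Finset ι) (hN : ∀ t ∈ T, ¬ IsLarge m (A ∩ N t)) :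
    IsLarge m (A \ ⋃ t ∈ T, N t) := by
  classical
  induction T using Finset.induction_on with
  | empty => simpa using hA
  | insert t T _ ih =>
    have hT := ih fun s hs => hN s (Finset.mem_insert_of_mem hs)
    rw [← Set.sdiff_union_inter (A \ ⋃ s ∈ T, N s) (N t)] at hT
    rcases hT.of_union with h | h
    · refine h.mono ?_
      rw [Finset.set_biUnion_insert, Set.sdiff_sdiff, Set.union_comm]
    · exact absurd (h.mono (Set.inter_subset_inter_left _ Set.sdiff_subset))
        (hN t (Finset.mem_insert_self _ _))

/-- A large set of rank `m + n` contains `ω ^ n` consecutive large blocks of rank `m`. -/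
theorem exists_blocks {m n : ℕ} {A : Set X} (hA : IsLarge (m + n) A) :
    ∃ F : Ordinal.{0} → Set X, (∀ o < ω ^ n, F o ⊆ A ∧ IsLarge m (F o)) ∧
      ∀ o p, o < p → p < ω ^ n → ∀ x ∈ F o, ∀ y ∈ F p, x < y := by
  induction n generalizing A with
  | zero =>
    refine ⟨fun _ => A, fun _ _ => ⟨subset_rfl, hA⟩, fun o p hop hp => ?_⟩
    rw [pow_zero, Order.lt_one_iff] at hp
    exact absurd (hp ▸ hop) not_lt_zero
  | succ n ih =>
    obtain ⟨S, hS, hlt⟩ := hA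
    choose F hF hFlt using fun i => ih (hS i).2
    have hpos : (ω ^ n : Ordinal.{0}) ≠ 0 := pow_ne_zero n Ordinal.omega0_ne_zero
    let q : Ordinal.{0} → ℕ := fun o => Cardinal.toNat (o / ω ^ n).card
    have hq : ∀ o < (ω ^ (n + 1) : Ordinal.{0}), (q o : Ordinal.{0}) = o / ω ^ n := by
      intro o ho
      rw [pow_succ] at ho
      obtain ⟨i, hi⟩ := Ordinal.lt_omega0.1 ((Ordinal.lt_mul_iff_div_lt hpos).1 ho)
      simp [q, hi]
    have hmod : ∀ o : Ordinal.{0}, o % ω ^ n < ω ^ n := fun o => Ordinal.mod_lt o hpos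
    refine ⟨fun o => F (q o) (o % ω ^ n), fun o ho => ?_, fun o p hop hp x hx y hy => ?_⟩
    · exact ⟨(hF _ _ (hmod o)).1.trans (hS _).1, (hF _ _ (hmod o)).2⟩
    · have hqo := hq o (hop.trans hp)
      have hqp := hq p hp
      have hle : q o ≤ q p := by
        rw [← Nat.cast_le (α := Ordinal.{0}), hqo, hqp]
        exact Ordinal.div_le_left hop.le _
      rcases hle.lt_or_eq with h | h
      · exact hlt _ _ h x ((hF _ _ (hmod o)).1 hx) y ((hF _ _ (hmod p)).1 hy)
      · change y ∈ F (q p) (p % ω ^ n) at hy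
        rw [← h] at hy
        refine hFlt _ _ _ ?_ (hmod p) x hx y hy
        rw [← Ordinal.div_add_mod o (ω ^ n), ← Ordinal.div_add_mod p (ω ^ n), ← hqo, ← hqp, h,
          add_lt_add_iff_left] at hop
        exact hop

end

theorem Ico_add_omega0_pow (m : ℕ) (a : Ordinal.{0}) : IsLarge m (Set.Ico a (a + ω ^ m)) := by
  induction m generalizing a with
  | zero => exact ⟨a, by simp⟩
  | succ m ih =>
    have hsucc : ∀ i : ℕ, a + ω ^ m * i + ω ^ m = a + ω ^ m * (i + 1 : ℕ) := fun i => by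
      rw [Nat.cast_succ, mul_add, mul_one, add_assoc]
    have hmono : ∀ i j : ℕ, i ≤ j → a + ω ^ m * i ≤ a + ω ^ m * j := fun i j hij => by gcongr
    refine ⟨fun i => Set.Ico (a + ω ^ m * i) (a + ω ^ m * i + ω ^ m), fun i => ⟨?_, ih _⟩,
      fun i j hij x hx y hy => ?_⟩
    · refine Set.Ico_subset_Ico le_self_add ?_
      rw [hsucc, pow_succ]
      gcongr
      exact (Ordinal.natCast_lt_omega0 _).le
    · refine hx.2.trans_le (le_trans ?_ hy.1)
      rw [hsucc]
      exact hmono _ _ hij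

end IsLarge

theorem countable_Iio_omega0_pow (n : ℕ) : (Set.Iio (ω ^ n : Ordinal.{0})).Countable := by
  rw [← Cardinal.le_aleph0_iff_set_countable, Cardinal.mk_Iio_ordinal, Cardinal.lift_le_aleph0]
  rcases eq_or_ne n 0 with rfl | hn
  · simp
  · rw [← Ordinal.opow_natCast, Ordinal.card_omega0_opow (by exact_mod_cast hn)]
    simp

/-- If every finite set can be extended by an element of each `F n`, then there is a sequence of
elements of the `F n` any two of which are related. -/
theorem exists_transversal_of_forall_finset_exists {X : Type*} (F : ℕ → Set X)
    (r : X → X → Prop) (h : ∀ (T : Finset X) (n : ℕ), ∃ y ∈ F n, ∀ t ∈ T, r t y) :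
    ∃ x : ℕ → X, (∀ n, x n ∈ F n) ∧ ∀ m n, m < n → r (x m) (x n) := by
  classical
  choose next hmem hr using h
  let T : ℕ → Finset X := fun n => Nat.rec ∅ (fun n T => insert (next T n) T) n
  have hT : Monotone T := monotone_nat_of_le_succ fun n => Finset.subset_insert _ _
  exact ⟨fun n => next (T n) n, fun n => hmem _ _,
    fun m n hmn => hr _ _ _ (hT (Nat.succ_le_of_lt hmn) (Finset.mem_insert_self _ _))⟩

theorem otype_image_Iio {g : Ordinal.{0} → Ordinal.{0}} {α : Ordinal.{0}}
    (hg : StrictMonoOn g (Set.Iio α)) : otype (g '' Set.Iio α) = Ordinal.lift.{1} α := by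
  rw [otype, ← Ordinal.type_lt_Iio]
  exact (hg.orderIso g _).toRelIsoLT.ordinalType_congr.symm

theorem otype_coe_finset (C : Finset Ordinal.{0}) : otype (C : Set Ordinal.{0}) = C.card := by
  rw [otype, Ordinal.type_fintype]
  simp

/-- Every colouring of a large set of rank `n * k` has a `0`-homogeneous set of type `ω ^ n` or a
`1`-homogeneous set of size `k`. -/
theorem IsLarge.exists_monoColor (f : Finset Ordinal.{0} → Fin 2) (n k : ℕ) {A : Set Ordinal.{0}}
    (hA : IsLarge (n * k) A) :
    (∃ B ⊆ A, otype B = Ordinal.lift.{1} (ω ^ n : Ordinal.{0}) ∧ MonoColor f B 0) ∨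
      ∃ C : Finset Ordinal.{0}, (C : Set Ordinal.{0}) ⊆ A ∧ C.card = k ∧ MonoColor f C 1 := by
  induction k generalizing A with
  | zero => exact Or.inr ⟨∅, by simp [MonoColor]⟩
  | succ k ih =>
    let N : Ordinal.{0} → Set Ordinal.{0} := fun t => {y | t ∈ A ∧ y ≠ t ∧ f {t, y} = 1}
    by_cases hN : ∃ t ∈ A, IsLarge (n * k) (A ∩ N t)
    · obtain ⟨t, htA, ht⟩ := hN
      rcases ih ht with ⟨B, hBA, hB⟩ | ⟨C, hCA, hC, hmono⟩
      · exact Or.inl ⟨B, hBA.trans Set.inter_subset_left, hB⟩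
      · refine Or.inr ⟨insert t C, ?_, ?_, ?_⟩
        · rw [Finset.coe_insert]
          exact Set.insert_subset htA (hCA.trans Set.inter_subset_left)
        · rw [Finset.card_insert_of_notMem fun htC => (hCA htC).2.2.1 rfl, hC]
        · rw [Finset.coe_insert]
          rintro x (rfl | hx) y (rfl | hy) hxy
          · exact absurd rfl hxy
          · exact (hCA hy).2.2.2
          · rw [Finset.pair_comm]
            exact (hCA hx).2.2.2
          · exact hmono x hx y hy hxy
    · push Not at hN
      obtain ⟨F, hF, hlt⟩ := IsLarge.exists_blocks (m := n * k) (n := n) hA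
      have hne : (Set.Iio (ω ^ n : Ordinal.{0})).Nonempty :=
        ⟨0, pow_pos Ordinal.omega0_pos n⟩
      obtain ⟨d, hd⟩ := (countable_Iio_omega0_pow n).exists_eq_range hne
      have hdlt : ∀ i, d i < ω ^ n := fun i => hd.symm.subset (Set.mem_range_self i)
      obtain ⟨x, hxF, hx⟩ := exists_transversal_of_forall_finset_exists (fun i => F (d i))
        (fun t y => y ∉ N t) fun T i => by
          obtain ⟨hFA, hFL⟩ := hF (d i) (hdlt i)
          obtain ⟨y, hyF, hy⟩ := (hFL.diff_biUnion N T fun t _ h => by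
            obtain ⟨z, hz⟩ := h.nonempty
            exact hN t hz.2.1 (h.mono (Set.inter_subset_inter_left _ hFA))).nonempty
          exact ⟨y, hyF, fun t ht hyt => hy (Set.mem_biUnion ht hyt)⟩
      have hxA : ∀ i, x i ∈ A := fun i => (hF _ (hdlt i)).1 (hxF i)
      have hcol : ∀ i j, i < j → x i ≠ x j → f {x i, x j} = 0 := by
        intro i j hij hne
        by_contra h0
        exact hx i j hij ⟨hxA i, hne.symm, by omega⟩
      have hsurj : ∀ o < (ω ^ n : Ordinal.{0}), ∃ i, d i = o := fun o ho => hd.subset ho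
      choose! e he using hsurj
      refine Or.inl ⟨(x ∘ e) '' Set.Iio (ω ^ n), ?_, otype_image_Iio ?_, ?_⟩
      · rintro _ ⟨o, -, rfl⟩
        exact hxA _
      · intro o ho p hp hop
        exact hlt o p hop hp _ (by simpa [he o ho] using hxF (e o)) _
          (by simpa [he p hp] using hxF (e p))
      · rintro _ ⟨o, -, rfl⟩ _ ⟨p, -, rfl⟩ hne
        rcases lt_trichotomy (e o) (e p) with h | h | h
        · exact hcol _ _ h hne
        · exact absurd (congrArg x h) hne
        · rw [Finset.pair_comm]
          exact hcol _ _ h hne.symm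

theorem stmt13 (n k : ℕ) :
    PartRel (Ordinal.omega0 ^ ((n * k : ℕ) : Ordinal))
      (Ordinal.omega0 ^ (n : Ordinal)) k := by
  intro f
  rw [Ordinal.opow_natCast, Ordinal.opow_natCast]
  have hA : IsLarge (n * k) (Set.Iio (ω ^ (n * k) : Ordinal.{0})) :=
    (IsLarge.Ico_add_omega0_pow (n * k) 0).mono fun x hx => by simpa using hx.2
  rcases hA.exists_monoColor f n k with h | ⟨C, hCA, hC, hmono⟩
  · exact Or.inl h
  · exact Or.inr ⟨C, hCA, by rw [otype_coe_finset, hC, Ordinal.lift_natCast], hmono⟩
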